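/- Let P be a finite multiset of labeled points in ℝ^d with optimal monotone error k*. When the RPE algorithm is run on P, the expected error of the resulting classifier h_RPE on P is at most 2·k*. -/

import Mathlib

open scoped Classical ENNReal

noncomputable section

/-- `p` dominates `q`: `p ≠ q` and `p[i] ≥ q[i]` for every coordinate `i`. -/
def dominates {d : ℕ} (p q : Fin d → ℝ) : Prop := p ≠ q ∧ ∀ i, q i ≤ p i

/-- `p ⪰ q`: `p = q` or `p` dominates `q`. -/
def domEq {d : ℕ} (p q : Fin d → ℝ) : Prop := p = q ∨ dominates p q

/-- The error of classifier `h` on a labeled multiset `Q`. -/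
def errP {d : ℕ} (Q : Multiset ((Fin d → ℝ) × ℤ)) (h : (Fin d → ℝ) → ℤ) : ℕ :=
  Multiset.card (Q.filter (fun x => h x.1 ≠ x.2))

/-- One elimination step of RPE: remove from `P` every element `p ⪰ z` if
`label(z) = 1`, and every element `p ⪯ z` if `label(z) = −1`. -/
def Pz {d : ℕ} (P : Multiset ((Fin d → ℝ) × ℤ)) (z : (Fin d → ℝ) × ℤ) :
    Multiset ((Fin d → ℝ) × ℤ) :=
  if z.2 = 1 then P.filter (fun p => ¬ domEq p.1 z.1)
  else P.filter (fun p => ¬ domEq z.1 p.1)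

/-- The RPE algorithm with step budget `fuel`: while `P` is nonempty, probe a
uniformly random `z ∈ P`, add it to the output, and eliminate as in `Pz`.
Since each iteration removes at least the probed element, running it with
`fuel = |P|` realizes the RPE algorithm exactly. The result is the
distribution over the output set `Z` of probed elements. -/
def rpeAux {d : ℕ} : ℕ → Multiset ((Fin d → ℝ) × ℤ) → PMF (Multiset ((Fin d → ℝ) × ℤ))
  | 0, _ => PMF.pure 0
  | (fuel + 1), P =>
    if hP : P = 0 then PMF.pure 0
    else (PMF.ofMultiset P hP).bind fun z =>
      (rpeAux fuel (Pz P z)).map (fun Z => z ::ₘ Z)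

/-- The distribution over the output set `Z` produced by running RPE on `P`. -/
def rpe {d : ℕ} (P : Multiset ((Fin d → ℝ) × ℤ)) : PMF (Multiset ((Fin d → ℝ) × ℤ)) :=
  rpeAux (Multiset.card P) P

/-- The classifier `h_RPE` determined by the probed set `Z`. -/
def hRPE {d : ℕ} (Z : Multiset ((Fin d → ℝ) × ℤ)) : (Fin d → ℝ) → ℤ :=
  fun p => if ∃ z ∈ Z, z.2 = 1 ∧ domEq p z.1 then 1 else -1

theorem domEq_iff {d : ℕ} {p q : Fin d → ℝ} : domEq p q ↔ q ≤ p := by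
  unfold domEq dominates
  constructor
  · rintro (rfl | h)
    · exact le_rfl
    · exact h.2
  · intro h
    by_cases hpq : p = q
    · exact Or.inl hpq
    · exact Or.inr ⟨hpq, h⟩

/-- Probing `z` eliminates `p`. -/
def eliminates {d : ℕ} (z p : (Fin d → ℝ) × ℤ) : Prop :=
  if z.2 = 1 then z.1 ≤ p.1 else p.1 ≤ z.1

theorem Pz_eq_filter {d : ℕ} (P : Multiset ((Fin d → ℝ) × ℤ)) (z : (Fin d → ℝ) × ℤ) :
    Pz P z = P.filter (fun p => ¬ eliminates z p) := by
  unfold Pz eliminates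
  split_ifs <;> simp only [domEq_iff]

theorem card_Pz_lt {d : ℕ} {P : Multiset ((Fin d → ℝ) × ℤ)} {z : (Fin d → ℝ) × ℤ}
    (hz : z ∈ P) : Multiset.card (Pz P z) < Multiset.card P := by
  rw [Pz_eq_filter]
  refine Multiset.card_lt_card (lt_of_le_of_ne (Multiset.filter_le _ _) fun h => ?_)
  rw [Multiset.filter_eq_self] at h
  apply h z hz
  unfold eliminates
  split_ifs <;> exact le_rfl

theorem PMF.tsum_bind_mul {α β : Type*} (p : PMF α) (f : α → PMF β) (g : β → ℝ≥0∞) :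
    ∑' b, (p.bind f) b * g b = ∑' a, p a * ∑' b, f a b * g b := by
  simp_rw [PMF.bind_apply, ← ENNReal.tsum_mul_right, ← ENNReal.tsum_mul_left]
  rw [ENNReal.tsum_comm]
  simp_rw [mul_assoc]

theorem PMF.tsum_pure_mul {α : Type*} (a : α) (g : α → ℝ≥0∞) :
    ∑' b, (PMF.pure a) b * g b = g a := by
  rw [tsum_eq_single a]
  · simp
  · intro b hb
    simp [PMF.pure_apply, hb]

theorem PMF.tsum_map_mul {α β : Type*} (p : PMF α) (f : α → β) (g : β → ℝ≥0∞) :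
    ∑' b, (p.map f) b * g b = ∑' a, p a * g (f a) := by
  rw [PMF.map, PMF.tsum_bind_mul]
  simp only [Function.comp_apply, PMF.tsum_pure_mul]

theorem PMF.tsum_ofMultiset_mul {α : Type*} (s : Multiset α) (hs : s ≠ 0) (g : α → ℝ≥0∞) :
    ∑' a, (PMF.ofMultiset s hs) a * g a = (s.map g).sum / Multiset.card s := by
  rw [tsum_eq_sum (s := s.toFinset), Finset.sum_multiset_map_count, div_eq_mul_inv,
    Finset.sum_mul]
  · refine Finset.sum_congr rfl fun a _ => ?_
    rw [PMF.ofMultiset_apply, nsmul_eq_mul, div_eq_mul_inv]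
    ring
  · intro a ha
    rw [PMF.ofMultiset_apply_of_notMem hs (by simpa using ha), zero_mul]

theorem mem_of_mem_support_rpeAux {d : ℕ} (fuel : ℕ) (P Z : Multiset ((Fin d → ℝ) × ℤ))
    (hZ : Z ∈ (rpeAux fuel P).support) : ∀ z ∈ Z, z ∈ P := by
  induction fuel generalizing P Z with
  | zero =>
    simp only [rpeAux, PMF.support_pure, Set.mem_singleton_iff] at hZ
    simp [hZ]
  | succ n ih =>
    rw [rpeAux] at hZ
    split_ifs at hZ with hP
    · simp only [PMF.support_pure, Set.mem_singleton_iff] at hZ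
      simp [hZ]
    · rw [PMF.mem_support_bind_iff] at hZ
      obtain ⟨z, hz, hZ⟩ := hZ
      rw [PMF.mem_support_map_iff] at hZ
      obtain ⟨Y, hY, rfl⟩ := hZ
      intro y hy
      rcases Multiset.mem_cons.1 hy with rfl | hy
      · simpa using hz
      · have h := ih _ _ hY y hy
        rw [Pz_eq_filter] at h
        exact Multiset.mem_of_mem_filter h

theorem hRPE_cons_of_eliminates {d : ℕ} {P Z : Multiset ((Fin d → ℝ) × ℤ)}
    {z p : (Fin d → ℝ) × ℤ} (hz : z.2 = 1 ∨ z.2 = -1) (hZ : ∀ y ∈ Z, y ∈ Pz P z)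
    (hp : eliminates z p) : hRPE (z ::ₘ Z) p.1 = z.2 := by
  unfold hRPE
  rcases hz with hz | hz
  · rw [if_pos, hz]
    refine ⟨z, Multiset.mem_cons_self _ _, hz, ?_⟩
    simpa [eliminates, hz, domEq_iff] using hp
  · rw [if_neg, hz]
    rintro ⟨y, hy, hy1, hyp⟩
    rcases Multiset.mem_cons.1 hy with rfl | hy
    · omega
    · have h := hZ y hy
      rw [Pz_eq_filter] at h
      apply (Multiset.mem_filter.1 h).2
      have hz1 : z.2 ≠ 1 := by omega
      simp only [eliminates, hz1, if_false] at hp ⊢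
      exact (domEq_iff.1 hyp).trans hp

theorem hRPE_cons_of_not_eliminates {d : ℕ} {Z : Multiset ((Fin d → ℝ) × ℤ)}
    {z p : (Fin d → ℝ) × ℤ} (hp : ¬ eliminates z p) : hRPE (z ::ₘ Z) p.1 = hRPE Z p.1 := by
  unfold hRPE
  congr 1
  simp only [Multiset.mem_cons, exists_eq_or_imp, eq_iff_iff, or_iff_right_iff_imp]
  rintro ⟨hz, hpz⟩
  simp only [eliminates, hz, if_true] at hp
  exact absurd (domEq_iff.1 hpz) hp

/-- The number of elements of `P` eliminated by `z` whose label differs from that of `z`. -/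
def mislabeled {d : ℕ} (P : Multiset ((Fin d → ℝ) × ℤ)) (z : (Fin d → ℝ) × ℤ) : ℕ :=
  Multiset.card (P.filter (fun p => eliminates z p ∧ z.2 ≠ p.2))

theorem errP_eq_add {d : ℕ} (P : Multiset ((Fin d → ℝ) × ℤ)) (z : (Fin d → ℝ) × ℤ)
    (h : (Fin d → ℝ) → ℤ) :
    errP P h = Multiset.card (P.filter (fun p => eliminates z p ∧ h p.1 ≠ p.2))
      + errP (Pz P z) h := by
  unfold errP
  rw [Pz_eq_filter, Multiset.filter_filter, ← Multiset.card_add,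
    ← Multiset.filter_add_not (fun p => eliminates z p) (P.filter fun x => h x.1 ≠ x.2)]
  simp only [Multiset.filter_filter, and_comm]

theorem errP_hRPE_cons {d : ℕ} {P Z : Multiset ((Fin d → ℝ) × ℤ)}
    {z : (Fin d → ℝ) × ℤ} (hz : z.2 = 1 ∨ z.2 = -1) (hZ : ∀ y ∈ Z, y ∈ Pz P z) :
    errP P (hRPE (z ::ₘ Z)) = mislabeled P z + errP (Pz P z) (hRPE Z) := by
  rw [errP_eq_add P z]
  congr 1
  · unfold mislabeled
    congr 1
    refine Multiset.filter_congr fun p _ => and_congr_right fun hp => ?_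
    rw [hRPE_cons_of_eliminates hz hZ hp]
  · unfold errP
    congr 1
    refine Multiset.filter_congr fun p hp => ?_
    rw [Pz_eq_filter] at hp
    rw [hRPE_cons_of_not_eliminates (Multiset.mem_filter.1 hp).2]

theorem Multiset.card_filter_eq_sum_map_ite {α : Type*} (s : Multiset α) (q : α → Prop)
    [DecidablePred q] :
    Multiset.card (s.filter q) = (s.map fun a => if q a then 1 else 0).sum := by
  induction s using Multiset.induction_on with
  | empty => simp
  | cons a s ih =>
    by_cases ha : q a
    · simp [ha, ih, add_comm]
    · simp [ha, ih]

/-- Every mislabeled pair contains an element on which a monotone classifier errs, and that element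
is eliminated by the other one. -/
theorem mislabeled_pair {d : ℕ} {h : (Fin d → ℝ) → ℤ}
    (hmono : ∀ p q : Fin d → ℝ, dominates p q → h q ≤ h p) {z p : (Fin d → ℝ) × ℤ}
    (hz : z.2 = 1 ∨ z.2 = -1) (hp : p.2 = 1 ∨ p.2 = -1)
    (hzp : eliminates z p ∧ z.2 ≠ p.2) :
    (eliminates z p ∧ h p.1 ≠ p.2) ∨ (eliminates p z ∧ h z.1 ≠ z.2) := by
  have hmono' : ∀ p q : Fin d → ℝ, q ≤ p → h q ≤ h p := by
    intro p q hqp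
    rcases domEq_iff.2 hqp with rfl | hd
    · exact le_rfl
    · exact hmono p q hd
  obtain ⟨hel, hne⟩ := hzp
  by_cases hhp : h p.1 = p.2
  · right
    rcases hz with hz | hz
    · have hp : p.2 = -1 := by omega
      simp only [eliminates, hz, if_true] at hel
      have := hmono' _ _ hel
      refine ⟨by simpa [eliminates, hp] using hel, by omega⟩
    · have hp : p.2 = 1 := by omega
      simp only [eliminates, show z.2 ≠ 1 by omega, if_false] at hel
      have := hmono' _ _ hel
      refine ⟨by simpa [eliminates, hp] using hel, by omega⟩
  · exact Or.inl ⟨hel, hhp⟩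

theorem sum_mislabeled_le {d : ℕ} {P : Multiset ((Fin d → ℝ) × ℤ)}
    (hlab : ∀ x ∈ P, x.2 = 1 ∨ x.2 = (-1 : ℤ)) {h : (Fin d → ℝ) → ℤ}
    (hmono : ∀ p q : Fin d → ℝ, dominates p q → h q ≤ h p) :
    (P.map fun z => mislabeled P z).sum ≤
      2 * (P.map fun z =>
        Multiset.card (P.filter (fun p => eliminates z p ∧ h p.1 ≠ p.2))).sum := by
  simp only [mislabeled, Multiset.card_filter_eq_sum_map_ite]
  rw [two_mul]
  nth_rewrite 3 [Multiset.sum_map_sum_map]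
  rw [← Multiset.sum_map_add]
  refine Multiset.sum_map_le_sum_map _ _ fun z hz => ?_
  rw [← Multiset.sum_map_add]
  refine Multiset.sum_map_le_sum_map _ _ fun p hp => ?_
  have key := mislabeled_pair hmono (hlab z hz) (hlab p hp)
  by_cases hb : eliminates z p ∧ z.2 ≠ p.2
  · rcases key hb with hc | hc
    · rw [if_pos hb, if_pos hc]; omega
    · rw [if_pos hb, if_pos hc]; omega
  · rw [if_neg hb]; omega

theorem sum_mislabeled_add_errP_le {d : ℕ} {P : Multiset ((Fin d → ℝ) × ℤ)}
    (hlab : ∀ x ∈ P, x.2 = 1 ∨ x.2 = (-1 : ℤ)) {h : (Fin d → ℝ) → ℤ}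
    (hmono : ∀ p q : Fin d → ℝ, dominates p q → h q ≤ h p) :
    (P.map fun z => mislabeled P z + 2 * errP (Pz P z) h).sum ≤
      2 * errP P h * Multiset.card P := by
  have hconst : (P.map fun _ => errP P h).sum = Multiset.card P * errP P h := by simp
  rw [Multiset.map_congr rfl (fun z _ => errP_eq_add P z h), Multiset.sum_map_add] at hconst
  have hle := sum_mislabeled_le hlab hmono
  rw [Multiset.sum_map_add, Multiset.sum_map_mul_left]
  nlinarith

theorem tsum_rpeAux_mul_errP_le {d : ℕ} {h : (Fin d → ℝ) → ℤ}
    (hmono : ∀ p q : Fin d → ℝ, dominates p q → h q ≤ h p) (fuel : ℕ)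
    (P : Multiset ((Fin d → ℝ) × ℤ)) (hfuel : Multiset.card P ≤ fuel)
    (hlab : ∀ x ∈ P, x.2 = 1 ∨ x.2 = (-1 : ℤ)) :
    ∑' Z, (rpeAux fuel P) Z * (errP P (hRPE Z) : ℝ≥0∞) ≤ 2 * (errP P h : ℝ≥0∞) := by
  induction fuel generalizing P with
  | zero =>
    obtain rfl : P = 0 := by simpa using hfuel
    simp [errP]
  | succ n ih =>
    by_cases hP : P = 0
    · subst hP
      simp [errP]
    rw [rpeAux, dif_neg hP, PMF.tsum_bind_mul, PMF.tsum_ofMultiset_mul]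
    refine ENNReal.div_le_of_le_mul ?_
    refine le_trans (b := (((P.map fun z => mislabeled P z + 2 * errP (Pz P z) h).sum : ℕ) : ℝ≥0∞))
      ?_ (by exact_mod_cast sum_mislabeled_add_errP_le hlab hmono)
    rw [Nat.cast_multiset_sum, Multiset.map_map]
    refine Multiset.sum_map_le_sum_map _ _ fun z hz => ?_
    rw [PMF.tsum_map_mul]
    have hcons : ∀ Z, (rpeAux n (Pz P z)) Z * (errP P (hRPE (z ::ₘ Z)) : ℝ≥0∞) =
        (rpeAux n (Pz P z)) Z * (mislabeled P z : ℝ≥0∞) +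
          (rpeAux n (Pz P z)) Z * (errP (Pz P z) (hRPE Z) : ℝ≥0∞) := by
      intro Z
      by_cases hZ : (rpeAux n (Pz P z)) Z = 0
      · simp [hZ]
      · rw [errP_hRPE_cons (hlab z hz)
          (mem_of_mem_support_rpeAux _ _ _ ((PMF.mem_support_iff _ _).2 hZ)), Nat.cast_add, mul_add]
    simp_rw [hcons]
    rw [ENNReal.tsum_add, ENNReal.tsum_mul_right, PMF.tsum_coe, one_mul]
    have hrec := ih (Pz P z) (by have := card_Pz_lt hz; omega) fun x hx => by
      rw [Pz_eq_filter] at hx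
      exact hlab x (Multiset.mem_of_mem_filter hx)
    simp only [Function.comp_apply, Nat.cast_add, Nat.cast_mul, Nat.cast_ofNat]
    gcongr

/-- The expected error on `P` of the classifier `h_RPE` produced by running
RPE on `P` is at most twice the optimal monotone error `k*` of `P`. -/
theorem stmt4 {d : ℕ} (P : Multiset ((Fin d → ℝ) × ℤ))
    (hlab : ∀ x ∈ P, x.2 = 1 ∨ x.2 = (-1 : ℤ))
    (kstar : ℕ)
    (hkstar : kstar = sInf {m : ℕ | ∃ h : (Fin d → ℝ) → ℤ,
      ((∀ x, h x = 1 ∨ h x = -1) ∧ ∀ p q : Fin d → ℝ, dominates p q → h q ≤ h p) ∧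
      errP P h = m}) :
    ∑' Z : Multiset ((Fin d → ℝ) × ℤ), (rpe P) Z * (errP P (hRPE Z) : ℝ≥0∞)
      ≤ 2 * (kstar : ℝ≥0∞) := by
  have hne : {m : ℕ | ∃ h : (Fin d → ℝ) → ℤ,
      ((∀ x, h x = 1 ∨ h x = -1) ∧ ∀ p q : Fin d → ℝ, dominates p q → h q ≤ h p) ∧
      errP P h = m}.Nonempty :=
    ⟨_, fun _ => 1, ⟨fun _ => Or.inl rfl, fun _ _ _ => le_rfl⟩, rfl⟩
  obtain ⟨h, ⟨-, hmono⟩, hk⟩ := Nat.sInf_mem hne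
  rw [hkstar, ← hk]
  exact tsum_rpeAux_mul_errP_le hmono _ P le_rfl hlab
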